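/- There exists a constant K₂ > 1 such that: (i) for all nonempty words 𝐚, 𝐛 with 𝐚 ⇝ 𝐛, one has K₂⁻¹·Υ_𝐚·Υ_𝐛 ≤ Υ_{𝐚′𝐛} ≤ K₂·Υ_𝐚·Υ_𝐛; and (ii) for all words 𝐚, 𝐛 with 𝐚 → 𝐛, one has K₂⁻¹·Υ_𝐚·Υ_𝐛 ≤ Υ_{𝐚𝐛} ≤ K₂·Υ_𝐚·Υ_𝐛. -/

import Mathlib

open MeasureTheory

/-- `SL(2,ℝ)`. -/
abbrev SL2 : Type := Matrix.SpecialLinearGroup (Fin 2) ℝ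

/-- The Möbius transformation of `g ∈ SL(2,ℝ)` acting on `ℂ` (junk at the pole). -/
noncomputable def mobiusC (g : SL2) (z : ℂ) : ℂ :=
  ((g.1 0 0 : ℂ) * z + (g.1 0 1 : ℂ)) / ((g.1 1 0 : ℂ) * z + (g.1 1 1 : ℂ))

/-- The Möbius transformation of `g ∈ SL(2,ℝ)` acting on `ℝ` (junk at the pole). -/
noncomputable def mobiusR (g : SL2) (x : ℝ) : ℝ :=
  (g.1 0 0 * x + g.1 0 1) / (g.1 1 0 * x + g.1 1 1)

/-- The derivative `γ'(z) = (uz+v)⁻²` of the Möbius transformation of `g`. -/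
noncomputable def mobiusDerivC (g : SL2) (z : ℂ) : ℂ :=
  ((g.1 1 0 : ℂ) * z + (g.1 1 1 : ℂ))⁻¹ ^ 2

/-- The derivative `γ'(x) = (ux+v)⁻²` of the Möbius transformation of `g`, real version. -/
noncomputable def mobiusDerivR (g : SL2) (x : ℝ) : ℝ :=
  (g.1 1 0 * x + g.1 1 1)⁻¹ ^ 2

/-- The Möbius transformation of `g ∈ SL(2,ℝ)` acting on the Riemann sphere `ℂ ∪ {∞}`. -/
noncomputable def mobiusS (g : SL2) (z : OnePoint ℂ) : OnePoint ℂ :=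
  Option.elim z
    (if (g.1 1 0 : ℝ) = 0 then OnePoint.infty else (((g.1 0 0 / g.1 1 0 : ℝ) : ℂ) : OnePoint ℂ))
    (fun w => if ((g.1 1 0 : ℂ) * w + (g.1 1 1 : ℂ)) = 0 then OnePoint.infty
      else ((mobiusC g w : ℂ) : OnePoint ℂ))

/-- The involution `a ↦ ā = a + r mod 2r` on the alphabet `𝒜 = Fin (2r)`. -/
def wordBar {r : ℕ} (a : Fin (2 * r)) : Fin (2 * r) :=
  ⟨(a.1 + r) % (2 * r), Nat.mod_lt _ (Nat.lt_of_le_of_lt (Nat.zero_le _) a.isLt)⟩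

/-- A word: a finite sequence of letters with no adjacent letter equal to the bar of the
previous one. -/
def IsWord {r : ℕ} (w : List (Fin (2 * r))) : Prop :=
  w.Chain' (fun x y => x ≠ wordBar y)

/-- The mirror word `𝐚̄ = (ā_n, …, ā_1)`. -/
def mirror {r : ℕ} (w : List (Fin (2 * r))) : List (Fin (2 * r)) :=
  (w.map wordBar).reverse

/-- `𝐚 → 𝐛` : either word is empty, or the last letter of `𝐚` is not the bar of the first
letter of `𝐛`. -/
def arrow {r : ℕ} (w v : List (Fin (2 * r))) : Prop :=
  ∀ x ∈ w.getLast?, ∀ y ∈ v.head?, x ≠ wordBar y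

/-- `𝐚 ⇝ 𝐛` : both words are nonempty and the last letter of `𝐚` equals the first letter
of `𝐛`. -/
def wiggly {r : ℕ} (w v : List (Fin (2 * r))) : Prop :=
  w ≠ [] ∧ v ≠ [] ∧ w.getLast? = v.head?

/-- Schottky data: pairwise disjoint closed discs centered on the real line, paired by
elements of `SL(2,ℝ)`. -/
structure Schottky where
  r : ℕ
  two_le_r : 2 ≤ r
  center : Fin (2 * r) → ℝ
  radius : Fin (2 * r) → ℝ
  radius_pos : ∀ a, 0 < radius a
  g : Fin (2 * r) → SL2
  disjoint : ∀ a b : Fin (2 * r), a ≠ b →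
    Disjoint (closure (Metric.ball ((center a : ℂ)) (radius a)))
             (closure (Metric.ball ((center b : ℂ)) (radius b)))
  g_bar : ∀ a : Fin (2 * r), g (wordBar a) = (g a)⁻¹
  maps : ∀ a : Fin (2 * r),
    mobiusS (g a) '' (((fun w : ℂ => (w : OnePoint ℂ)) ''
        Metric.ball ((center (wordBar a) : ℂ)) (radius (wordBar a)))ᶜ)
      = (fun w : ℂ => (w : OnePoint ℂ)) '' closure (Metric.ball ((center a : ℂ)) (radius a))

namespace Schottky

variable (S : Schottky)

/-- The open disc `D_a`. -/
def D (a : Fin (2 * S.r)) : Set ℂ := Metric.ball ((S.center a : ℂ)) (S.radius a)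

/-- The union `𝐃` of the open discs. -/
def Dall : Set ℂ := ⋃ a, S.D a

/-- The open interval `I_a = D_a ∩ ℝ`. -/
def Ireal (a : Fin (2 * S.r)) : Set ℝ := {x : ℝ | (x : ℂ) ∈ S.D a}

/-- The union `I` of the intervals `I_a`. -/
def Iall : Set ℝ := ⋃ a, S.Ireal a

/-- The group element `γ_𝐚 = γ_{a₁} ⋯ γ_{a_n}` associated to a word. -/
noncomputable def wprod (w : List (Fin (2 * S.r))) : SL2 := (w.map S.g).prod

/-- The Schottky group `Γ`, generated by the `γ_a`. -/
def SGroup : Subgroup SL2 := Subgroup.closure (Set.range S.g)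

theorem wprod_mem (w : List (Fin (2 * S.r))) : S.wprod w ∈ S.SGroup := by
  apply Subgroup.list_prod_mem
  intro x hx
  obtain ⟨a, -, rfl⟩ := List.mem_map.mp hx
  exact Subgroup.subset_closure ⟨a, rfl⟩

/-- `γ_𝐚` as an element of the Schottky group `Γ`. -/
noncomputable def wprodG (w : List (Fin (2 * S.r))) : S.SGroup := ⟨S.wprod w, S.wprod_mem w⟩

/-- The generator `γ_a` as an element of `Γ`. -/
noncomputable def genG (a : Fin (2 * S.r)) : S.SGroup :=
  ⟨S.g a, Subgroup.subset_closure ⟨a, rfl⟩⟩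

/-- The interval `I_𝐚 = γ_{𝐚'}(I_{a_n})` of a nonempty word. -/
noncomputable def Iset (w : List (Fin (2 * S.r))) : Set ℝ :=
  if h : w = [] then ∅ else mobiusR (S.wprod w.dropLast) '' S.Ireal (w.getLast h)

/-- `Υ_𝐚 = |I_𝐚|`, the length of the interval `I_𝐚`; `Υ_∅ = 1`. -/
noncomputable def ups (w : List (Fin (2 * S.r))) : ℝ :=
  if w = [] then 1 else (volume (S.Iset w)).toReal

/-- The Bourgain–Dyatlov partition `Z(τ)`. -/
def Zset (τ : ℝ) : Set (List (Fin (2 * S.r))) :=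
  {w | IsWord w ∧ w ≠ [] ∧ S.ups w ≤ τ ∧ τ < S.ups w.dropLast}

/-- The mirror set `Z̄(τ) = {𝐚 ∈ 𝒲 : 𝐚̄ ∈ Z(τ)}`. -/
def Zbar (τ : ℝ) : Set (List (Fin (2 * S.r))) :=
  {w | IsWord w ∧ mirror w ∈ S.Zset τ}

open Classical in
/-- The Bowen–Series map on the Riemann sphere (junk value `∞` off `𝐃`). -/
noncomputable def TS (z : OnePoint ℂ) : OnePoint ℂ :=
  if h : ∃ a : Fin (2 * S.r), ∃ w : ℂ, z = (w : OnePoint ℂ) ∧ w ∈ S.D a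
  then mobiusS (S.g h.choose)⁻¹ z
  else OnePoint.infty

/-- The limit set `Λ`: points of `𝐃` all of whose forward iterates under the Bowen–Series
map are defined (finite) and remain in `𝐃`. -/
def limitSet : Set ℂ :=
  {z : ℂ | ∀ n : ℕ, ∃ w : ℂ, (S.TS)^[n] (z : OnePoint ℂ) = (w : OnePoint ℂ) ∧ w ∈ S.Dall}

/-- The limit set, viewed inside `ℝ`. -/
def limitSetR : Set ℝ := {x : ℝ | (x : ℂ) ∈ S.limitSet}

/-- `δ`, the Hausdorff dimension of the limit set. -/
noncomputable def delta : ℝ := (dimH S.limitSet).toReal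

/-- `PowerPairs(τ)`: pairs `(𝐚,𝐛) ∈ Z̄(τ)²` such that `γ_{𝐚'}γ_{𝐛'}⁻¹` is a nontrivial
proper power in `Γ`. -/
def PowerPairs (τ : ℝ) : Set (List (Fin (2 * S.r)) × List (Fin (2 * S.r))) :=
  {p | p.1 ∈ S.Zbar τ ∧ p.2 ∈ S.Zbar τ ∧
    S.wprod p.1.dropLast * (S.wprod p.2.dropLast)⁻¹ ≠ 1 ∧
    ∃ γ₀ ∈ S.SGroup, ∃ q : ℕ, 2 ≤ q ∧
      S.wprod p.1.dropLast * (S.wprod p.2.dropLast)⁻¹ = (γ₀ : SL2) ^ q}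

end Schottky

theorem wordBar_wordBar {r : ℕ} (a : Fin (2 * r)) : wordBar (wordBar a) = a := by
  have ha := a.isLt
  ext
  simp only [wordBar]
  rcases lt_or_ge (a.1 + r) (2 * r) with h | h
  · rw [Nat.mod_eq_of_lt h, show a.1 + r + r = a.1 + 2 * r by ring, Nat.add_mod_right,
      Nat.mod_eq_of_lt ha]
  · have hmod : (a.1 + r) % (2 * r) = a.1 + r - 2 * r := by
      rw [Nat.mod_eq_sub_mod h, Nat.mod_eq_of_lt (by omega)]
    rw [hmod, Nat.mod_eq_of_lt (by omega)]
    omega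

theorem isWord_mirror {r : ℕ} {w : List (Fin (2 * r))} (hw : IsWord w) : IsWord (mirror w) := by
  refine List.isChain_reverse.2 ((List.isChain_map _).2 ?_)
  refine List.IsChain.imp ?_ hw
  intro x y hxy h
  refine hxy ?_
  rw [wordBar_wordBar] at h
  exact h.symm

theorem isWord_append {r : ℕ} {w v : List (Fin (2 * r))} (hw : IsWord w) (hv : IsWord v)
    (h : arrow w v) : IsWord (w ++ v) :=
  List.isChain_append.2 ⟨hw, hv, h⟩

/-- `x` lies within a multiplicative factor `M ^ n` of `1`. -/
def NearOne (M : ℝ) (n : ℕ) (x : ℝ) : Prop := (M ^ n)⁻¹ ≤ x ∧ x ≤ M ^ n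

namespace NearOne

variable {M x y : ℝ} {m n : ℕ}

theorem pos (hM : 1 ≤ M) (hx : NearOne M m x) : 0 < x :=
  lt_of_lt_of_le (by positivity) hx.1

theorem mul (hM : 1 ≤ M) (hx : NearOne M m x) (hy : NearOne M n y) :
    NearOne M (m + n) (x * y) := by
  have hx0 := hx.pos hM
  have hy0 := hy.pos hM
  refine ⟨?_, ?_⟩
  · rw [pow_add, mul_inv]
    exact mul_le_mul hx.1 hy.1 (by positivity) hx0.le
  · rw [pow_add]
    exact mul_le_mul hx.2 hy.2 hy0.le (by positivity)

theorem inv (hM : 1 ≤ M) (hx : NearOne M m x) : NearOne M m x⁻¹ :=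
  ⟨inv_anti₀ (hx.pos hM) hx.2, inv_le_of_inv_le₀ (by positivity) hx.1⟩

theorem mono (hM : 1 ≤ M) (hmn : m ≤ n) (hx : NearOne M m x) : NearOne M n x := by
  have h := pow_le_pow_right₀ hM hmn
  exact ⟨(inv_anti₀ (by positivity) h).trans hx.1, hx.2.trans h⟩

theorem one (hM : 1 ≤ M) : NearOne M n 1 :=
  ⟨inv_le_one_of_one_le₀ (one_le_pow₀ hM), one_le_pow₀ hM⟩

theorem eventually (hx : 0 < x) : ∀ᶠ M in Filter.atTop, NearOne M 1 x := by
  filter_upwards [Filter.eventually_ge_atTop x, Filter.eventually_ge_atTop x⁻¹] with M h h'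
  rw [NearOne, pow_one]
  exact ⟨inv_le_of_inv_le₀ hx h', h⟩

end NearOne

theorem volume_image_mobiusR (g : SL2) {L R : ℝ} (hLR : L ≤ R)
    (h : ∀ x ∈ Set.Icc L R, g.1 1 0 * x + g.1 1 1 ≠ 0) :
    (volume (mobiusR g '' Set.Ioo L R)).toReal
      = (R - L) / ((g.1 1 0 * L + g.1 1 1) * (g.1 1 0 * R + g.1 1 1)) := by
  have hdet : g.1 0 0 * g.1 1 1 - g.1 0 1 * g.1 1 0 = 1 := by
    rw [← Matrix.det_fin_two]; exact g.2
  have hcont : ContinuousOn (mobiusR g) (Set.Icc L R) := by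
    unfold mobiusR
    exact ContinuousOn.div (by fun_prop) (by fun_prop) h
  have hsub : ∀ x ∈ Set.Icc L R, ∀ y ∈ Set.Icc L R, mobiusR g y - mobiusR g x
      = (y - x) / ((g.1 1 0 * x + g.1 1 1) * (g.1 1 0 * y + g.1 1 1)) := by
    intro x hx y hy
    have h1 := h x hx
    have h2 := h y hy
    unfold mobiusR
    rw [div_sub_div _ _ h2 h1, mul_comm (g.1 1 0 * x + g.1 1 1)]
    congr 1
    linear_combination (y - x) * hdet
  have hpos : ∀ x ∈ Set.Icc L R, ∀ y ∈ Set.Icc L R,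
      0 < (g.1 1 0 * x + g.1 1 1) * (g.1 1 0 * y + g.1 1 1) := by
    intro x hx y hy
    by_contra hneg
    have hcont' : ContinuousOn (fun x => g.1 1 0 * x + g.1 1 1) (Set.Icc L R) := by fun_prop
    have him := isPreconnected_Icc.image _ hcont'
    have key : ∀ u ∈ Set.Icc L R, ∀ v ∈ Set.Icc L R, g.1 1 0 * u + g.1 1 1 ≤ 0 →
        0 ≤ g.1 1 0 * v + g.1 1 1 → False := by
      intro u hu v hv h1 h2
      obtain ⟨t, ht, ht0⟩ := him.Icc_subset ⟨u, hu, rfl⟩ ⟨v, hv, rfl⟩ ⟨h1, h2⟩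
      exact h t ht ht0
    rcases mul_nonpos_iff.1 (not_lt.1 hneg) with ⟨h1, h2⟩ | ⟨h1, h2⟩
    · exact key y hy x hx h2 h1
    · exact key x hx y hy h1 h2
  have hmono : MonotoneOn (mobiusR g) (Set.Icc L R) := by
    intro x hx y hy hxy
    have := hsub x hx y hy
    have h0 : 0 ≤ mobiusR g y - mobiusR g x := by
      rw [this]
      exact div_nonneg (sub_nonneg.2 hxy) (hpos x hx y hy).le
    linarith
  have hL := Set.left_mem_Icc.2 hLR
  have hR := Set.right_mem_Icc.2 hLR
  have hvol : volume (mobiusR g '' Set.Ioo L R)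
      = ENNReal.ofReal (mobiusR g R - mobiusR g L) := by
    apply le_antisymm
    · rw [← Real.volume_Icc]
      apply measure_mono
      rintro _ ⟨x, hx, rfl⟩
      have hx' := Set.Ioo_subset_Icc_self hx
      exact ⟨hmono hL hx' hx'.1, hmono hx' hR hx'.2⟩
    · rw [← Real.volume_Ioo]
      exact measure_mono (intermediate_value_Ioo hLR hcont)
  rw [hvol, ENNReal.toReal_ofReal (sub_nonneg.2 (hmono hL hR hLR)), hsub L hL R hR]

namespace Schottky

variable (S : Schottky)

/-- The closed real interval cut out by the closure of `D_a`. -/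
def closedInterval (a : Fin (2 * S.r)) : Set ℝ := Metric.closedBall (S.center a) (S.radius a)

theorem mem_closure_disc_iff {a : Fin (2 * S.r)} {x : ℝ} :
    (x : ℂ) ∈ closure (Metric.ball (S.center a : ℂ) (S.radius a)) ↔ x ∈ S.closedInterval a := by
  rw [closure_ball _ (S.radius_pos a).ne', closedInterval, Metric.mem_closedBall,
    Metric.mem_closedBall, Complex.dist_of_im_eq (by simp), Complex.ofReal_re, Complex.ofReal_re]

theorem Ireal_eq (a : Fin (2 * S.r)) :
    S.Ireal a = Set.Ioo (S.center a - S.radius a) (S.center a + S.radius a) := by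
  rw [← Real.ball_eq_Ioo]
  ext x
  rw [Ireal, Set.mem_ofPred_eq, D, Metric.mem_ball, Metric.mem_ball,
    Complex.dist_of_im_eq (by simp), Complex.ofReal_re, Complex.ofReal_re]

theorem disjoint_closedInterval {a b : Fin (2 * S.r)} (hab : a ≠ b) :
    Disjoint (S.closedInterval a) (S.closedInterval b) :=
  Set.disjoint_left.2 fun _ hx hy => Set.disjoint_left.1 (S.disjoint a b hab)
    (S.mem_closure_disc_iff.2 hx) (S.mem_closure_disc_iff.2 hy)

theorem mem_closedInterval_of_maps_infty (a : Fin (2 * S.r)) :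
    (S.g a).1 1 0 ≠ 0 ∧ (S.g a).1 0 0 / (S.g a).1 1 0 ∈ S.closedInterval a := by
  have hmem : mobiusS (S.g a) OnePoint.infty ∈ (fun w : ℂ => (w : OnePoint ℂ)) ''
      closure (Metric.ball (S.center a : ℂ) (S.radius a)) := by
    rw [← S.maps a]
    refine ⟨_, ?_, rfl⟩
    rintro ⟨w, -, hw⟩
    exact OnePoint.coe_ne_infty w hw
  obtain ⟨w, hw, hw'⟩ := hmem
  change (w : OnePoint ℂ) = (if (S.g a).1 1 0 = 0 then OnePoint.infty
    else ((((S.g a).1 0 0 / (S.g a).1 1 0 : ℝ) : ℂ) : OnePoint ℂ)) at hw'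
  split_ifs at hw' with h
  · exact absurd hw' (OnePoint.coe_ne_infty w)
  · rw [OnePoint.coe_eq_coe] at hw'
    exact ⟨h, S.mem_closure_disc_iff.1 (hw' ▸ hw)⟩

theorem mobiusR_mem_closedInterval {a b : Fin (2 * S.r)} (hab : a ≠ wordBar b) {x : ℝ}
    (hx : x ∈ S.closedInterval b) :
    (S.g a).1 1 0 * x + (S.g a).1 1 1 ≠ 0 ∧ mobiusR (S.g a) x ∈ S.closedInterval a := by
  have hba : b ≠ wordBar a := fun h => hab (by rw [h, wordBar_wordBar])
  have hmem : mobiusS (S.g a) ((x : ℂ) : OnePoint ℂ) ∈ (fun w : ℂ => (w : OnePoint ℂ)) ''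
      closure (Metric.ball (S.center a : ℂ) (S.radius a)) := by
    rw [← S.maps a]
    refine ⟨_, ?_, rfl⟩
    rintro ⟨w, hw, hw'⟩
    obtain rfl := OnePoint.coe_eq_coe.1 hw'
    exact Set.disjoint_left.1 (S.disjoint _ _ hba) (S.mem_closure_disc_iff.2 hx)
      (subset_closure hw)
  obtain ⟨w, hw, hw'⟩ := hmem
  change (w : OnePoint ℂ) = (if ((S.g a).1 1 0 : ℂ) * (x : ℂ) + ((S.g a).1 1 1 : ℂ) = 0
    then OnePoint.infty else ((mobiusC (S.g a) x : ℂ) : OnePoint ℂ)) at hw'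
  split_ifs at hw' with h
  · exact absurd hw' (OnePoint.coe_ne_infty w)
  · rw [OnePoint.coe_eq_coe] at hw'
    refine ⟨by exact_mod_cast h, S.mem_closure_disc_iff.1 ?_⟩
    convert hw using 1
    rw [hw', mobiusC, mobiusR]
    push_cast
    rfl

theorem wprod_append (w v : List (Fin (2 * S.r))) :
    S.wprod (w ++ v) = S.wprod w * S.wprod v := by
  simp [wprod]

theorem wprod_cons (a : Fin (2 * S.r)) (v : List (Fin (2 * S.r))) :
    S.wprod (a :: v) = S.g a * S.wprod v := by
  simp [wprod]

theorem wprod_mirror (w : List (Fin (2 * S.r))) : S.wprod (mirror w) = (S.wprod w)⁻¹ := by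
  rw [wprod, wprod, List.prod_inv_reverse, mirror, List.map_reverse, List.map_map, List.map_map]
  congr 3
  funext a
  exact S.g_bar a

/-- The image `γ_𝐚(∞)` is finite and lies in the closed interval of the first letter. -/
theorem image_infty_mem (a : Fin (2 * S.r)) (v : List (Fin (2 * S.r))) (h : IsWord (a :: v)) :
    (S.wprod (a :: v)).1 1 0 ≠ 0 ∧
      (S.wprod (a :: v)).1 0 0 / (S.wprod (a :: v)).1 1 0 ∈ S.closedInterval a := by
  induction v generalizing a with
  | nil => simpa [wprod] using S.mem_closedInterval_of_maps_infty a
  | cons b v ih =>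
    obtain ⟨hab, hw⟩ := List.isChain_cons_cons.1 h
    obtain ⟨h0, hmem⟩ := ih b hw
    obtain ⟨h1, h2⟩ := S.mobiusR_mem_closedInterval hab hmem
    rw [wprod_cons]
    generalize S.wprod (b :: v) = k at *
    rw [mobiusR] at h2
    simp only [Matrix.SpecialLinearGroup.coe_mul, Matrix.mul_apply, Fin.sum_univ_two]
    have e : (S.g a).1 1 0 * k.1 0 0 + (S.g a).1 1 1 * k.1 1 0
        = k.1 1 0 * ((S.g a).1 1 0 * (k.1 0 0 / k.1 1 0) + (S.g a).1 1 1) := by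
      field_simp
    have e' : (S.g a).1 0 0 * k.1 0 0 + (S.g a).1 0 1 * k.1 1 0
        = k.1 1 0 * ((S.g a).1 0 0 * (k.1 0 0 / k.1 1 0) + (S.g a).1 0 1) := by
      field_simp
    rw [e, e', mul_div_mul_left _ _ h0]
    exact ⟨mul_ne_zero h0 h1, h2⟩

/-- The pole `γ_𝐚⁻¹(∞)` is finite and lies in the closed interval of the bar of the last
letter. -/
theorem pole_mem (v : List (Fin (2 * S.r))) (a : Fin (2 * S.r)) (h : IsWord (v ++ [a])) :
    (S.wprod (v ++ [a])).1 1 0 ≠ 0 ∧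
      -((S.wprod (v ++ [a])).1 1 1 / (S.wprod (v ++ [a])).1 1 0)
        ∈ S.closedInterval (wordBar a) := by
  have hm : mirror (v ++ [a]) = wordBar a :: mirror v := by simp [mirror]
  have hw := isWord_mirror h
  have key := S.image_infty_mem (wordBar a) (mirror v) (hm ▸ hw)
  rw [← hm, wprod_mirror, Matrix.SpecialLinearGroup.SL2_inv_expl] at key
  simpa [div_neg] using key

/-- `γ'` up to bounded factors is the inverse of the squared lower left entry of `γ`; the empty
word is given the value `1`. -/
noncomputable def lowerSq (w : List (Fin (2 * S.r))) : ℝ :=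
  if w = [] then 1 else ((S.wprod w).1 1 0) ^ 2

/-- `M` controls the sizes of, and the mutual distances between, the closed intervals, as well as
the lower left entries of the generators. -/
structure IsBound (M : ℝ) : Prop where
  one_lt : 1 < M
  dist : ∀ a b, a ≠ b → ∀ x ∈ S.closedInterval a, ∀ y ∈ S.closedInterval b,
    NearOne M 1 |x - y|
  length : ∀ a, NearOne M 1 (2 * S.radius a)
  gen : ∀ a, NearOne M 1 (S.lowerSq [a])

theorem exists_isBound : ∃ M, S.IsBound M := by
  have hdist : ∀ᶠ M in Filter.atTop, ∀ a b, a ≠ b → ∀ x ∈ S.closedInterval a,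
      ∀ y ∈ S.closedInterval b, NearOne M 1 |x - y| := by
    refine Filter.eventually_all.2 fun a => Filter.eventually_all.2 fun b => ?_
    by_cases hab : a = b
    · exact Filter.Eventually.of_forall fun M h => absurd hab h
    have hK : IsCompact (S.closedInterval a ×ˢ S.closedInterval b) :=
      (isCompact_closedBall _ _).prod (isCompact_closedBall _ _)
    have hne : (S.closedInterval a ×ˢ S.closedInterval b).Nonempty :=
      ⟨(S.center a, S.center b), Metric.mem_closedBall_self (S.radius_pos a).le,
        Metric.mem_closedBall_self (S.radius_pos b).le⟩
    have hc : ContinuousOn (fun p : ℝ × ℝ => |p.1 - p.2|)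
        (S.closedInterval a ×ˢ S.closedInterval b) := by fun_prop
    have hpos : ∀ p ∈ S.closedInterval a ×ˢ S.closedInterval b, 0 < |p.1 - p.2| := by
      rintro ⟨x, y⟩ ⟨hx, hy⟩
      refine abs_pos.2 (sub_ne_zero.2 fun h => ?_)
      exact Set.disjoint_left.1 (S.disjoint_closedInterval hab) hx (by convert hy)
    obtain ⟨p, hp, hmin⟩ := hK.exists_isMinOn hne hc
    obtain ⟨q, hq, hmax⟩ := hK.exists_isMaxOn hne hc
    filter_upwards [NearOne.eventually (hpos p hp), NearOne.eventually (hpos q hq)]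
      with M h1 h2 _ x hx y hy
    exact ⟨h1.1.trans (hmin (Set.mk_mem_prod hx hy)), (hmax (Set.mk_mem_prod hx hy)).trans h2.2⟩
  have hlen : ∀ᶠ M in Filter.atTop, ∀ a, NearOne M 1 (2 * S.radius a) :=
    Filter.eventually_all.2 fun a => NearOne.eventually (mul_pos two_pos (S.radius_pos a))
  have hgen : ∀ᶠ M in Filter.atTop, ∀ a, NearOne M 1 (S.lowerSq [a]) := by
    refine Filter.eventually_all.2 fun a => NearOne.eventually ?_
    have := (S.image_infty_mem a [] (List.isChain_singleton a)).1
    rw [lowerSq, if_neg (List.cons_ne_nil _ _)]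
    positivity
  obtain ⟨M, h1, h2, h3, h4⟩ :=
    ((Filter.eventually_gt_atTop 1).and (hdist.and (hlen.and hgen))).exists
  exact ⟨M, h1, h2, h3, h4⟩

theorem lowerSq_pos {w : List (Fin (2 * S.r))} (hw : IsWord w) : 0 < S.lowerSq w := by
  unfold lowerSq
  split_ifs with h
  · exact one_pos
  · obtain ⟨a, v, rfl⟩ := List.exists_cons_of_ne_nil h
    have := (S.image_infty_mem a v hw).1
    positivity

variable {S} {M : ℝ}

theorem IsBound.lowerSq_append (hM : S.IsBound M) {w v : List (Fin (2 * S.r))} (hw : IsWord w)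
    (hv : IsWord v) (h : arrow w v) :
    NearOne M 2 (S.lowerSq (w ++ v) / (S.lowerSq w * S.lowerSq v)) := by
  have hM1 := hM.one_lt.le
  have hw0 := S.lowerSq_pos hw
  have hv0 := S.lowerSq_pos hv
  rcases List.eq_nil_or_concat' w with rfl | ⟨u, a, rfl⟩
  · rw [List.nil_append, show S.lowerSq [] = 1 from if_pos rfl, one_mul, div_self hv0.ne']
    exact NearOne.one hM1
  rcases v with _ | ⟨b, t⟩
  · rw [List.append_nil, show S.lowerSq [] = 1 from if_pos rfl, mul_one, div_self hw0.ne']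
    exact NearOne.one hM1
  have hab : a ≠ wordBar b := h a (by simp) b (by simp)
  obtain ⟨h1, h2⟩ := S.pole_mem u a hw
  obtain ⟨h3, h4⟩ := S.image_infty_mem b t hv
  have hd := hM.dist b (wordBar a) (fun e => hab (by rw [e, wordBar_wordBar])) _ h4 _ h2
  rw [lowerSq, lowerSq, lowerSq, if_neg (by simp), if_neg (by simp), if_neg (by simp),
    wprod_append S (u ++ [a])]
  convert hd.mul hM1 hd using 1
  generalize S.wprod (u ++ [a]) = k at *
  generalize S.wprod (b :: t) = l at *
  rw [abs_mul_abs_self]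
  simp only [Matrix.SpecialLinearGroup.coe_mul, Matrix.mul_apply, Fin.sum_univ_two]
  field_simp
  ring

theorem IsBound.ups_concat (hM : S.IsBound M) {w : List (Fin (2 * S.r))} {b : Fin (2 * S.r)}
    (hw : IsWord w) (h : arrow w [b]) : NearOne M 3 (S.ups (w ++ [b]) * S.lowerSq w) := by
  have hM1 := hM.one_lt.le
  have hr := S.radius_pos b
  rw [ups, if_neg (by simp), Iset, dif_neg (by simp), List.dropLast_concat,
    List.getLast_append_singleton, Ireal_eq]
  have hIcc : Set.Icc (S.center b - S.radius b) (S.center b + S.radius b) = S.closedInterval b :=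
    Real.closedBall_eq_Icc.symm
  have hle : S.center b - S.radius b ≤ S.center b + S.radius b := by linarith
  have hL : S.center b - S.radius b ∈ S.closedInterval b := hIcc ▸ Set.left_mem_Icc.2 hle
  have hR : S.center b + S.radius b ∈ S.closedInterval b := hIcc ▸ Set.right_mem_Icc.2 hle
  have hlen : S.center b + S.radius b - (S.center b - S.radius b) = 2 * S.radius b := by ring
  rcases List.eq_nil_or_concat' w with rfl | ⟨u, a, rfl⟩
  · rw [volume_image_mobiusR _ hle (by simp [wprod]), hlen]
    convert (hM.length b).mono hM1 (by norm_num : 1 ≤ 3) using 1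
    simp [wprod, lowerSq]
  have hab : a ≠ wordBar b := h a (by simp) b (by simp)
  obtain ⟨h1, h2⟩ := S.pole_mem u a hw
  have hd := fun x hx => hM.dist b (wordBar a) (fun e => hab (by rw [e, wordBar_wordBar])) x hx _ h2
  rw [lowerSq, if_neg (by simp)]
  generalize S.wprod (u ++ [a]) = k at *
  have hden : ∀ x, k.1 1 0 * x + k.1 1 1 = k.1 1 0 * (x - -(k.1 1 1 / k.1 1 0)) := by
    intro x
    field_simp
    ring
  have hne : ∀ x ∈ S.closedInterval b, x - -(k.1 1 1 / k.1 1 0) ≠ 0 :=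
    fun x hx => abs_pos.1 ((hd x hx).pos hM1)
  have hvol := volume_image_mobiusR k hle
    fun x hx => by rw [hden]; exact mul_ne_zero h1 (hne x (hIcc ▸ hx))
  have hnn : |(volume (mobiusR k '' Set.Ioo (S.center b - S.radius b)
      (S.center b + S.radius b))).toReal * k.1 1 0 ^ 2| = _ := abs_of_nonneg (by positivity)
  rw [← hnn, hvol, hlen, hden, hden]
  convert (hM.length b).mul hM1 (((hd _ hL).inv hM1).mul hM1 ((hd _ hR).inv hM1)) using 1
  rw [← abs_inv, ← abs_inv, ← abs_mul, ← abs_of_pos (mul_pos two_pos hr), ← abs_mul,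
    abs_of_pos (mul_pos two_pos hr)]
  congr 1
  have := hne _ hL
  have := hne _ hR
  generalize S.center b - S.radius b - -(k.1 1 1 / k.1 1 0) = s at *
  generalize S.center b + S.radius b - -(k.1 1 1 / k.1 1 0) = t at *
  field_simp

theorem IsBound.ups_mul_lowerSq (hM : S.IsBound M) {w : List (Fin (2 * S.r))} (hw : IsWord w) :
    NearOne M 6 (S.ups w * S.lowerSq w) := by
  have hM1 := hM.one_lt.le
  rcases List.eq_nil_or_concat' w with rfl | ⟨u, a, rfl⟩
  · rw [ups, lowerSq, if_pos rfl, if_pos rfl, one_mul]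
    exact NearOne.one hM1
  obtain ⟨hu, ha, hua⟩ := List.isChain_append.1 hw
  have hu0 := S.lowerSq_pos hu
  have ha0 := S.lowerSq_pos ha
  convert ((hM.ups_concat hu hua).mul hM1 (hM.lowerSq_append hu ha hua)).mul hM1 (hM.gen a) using 1
  field_simp

end Schottky

/-- coarse multiplicativity of `Υ`: there is `K₂ > 1` such that
`K₂⁻¹ Υ_𝐚 Υ_𝐛 ≤ Υ_{𝐚'𝐛} ≤ K₂ Υ_𝐚 Υ_𝐛` whenever `𝐚 ⇝ 𝐛`, and
`K₂⁻¹ Υ_𝐚 Υ_𝐛 ≤ Υ_{𝐚𝐛} ≤ K₂ Υ_𝐚 Υ_𝐛` whenever `𝐚 → 𝐛`. -/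
theorem stmt_3 (S : Schottky) :
    ∃ K₂ : ℝ, 1 < K₂ ∧
      (∀ w v : List (Fin (2 * S.r)), IsWord w → IsWord v → w ≠ [] → v ≠ [] →
        wiggly w v →
          K₂⁻¹ * (S.ups w * S.ups v) ≤ S.ups (w.dropLast ++ v) ∧
          S.ups (w.dropLast ++ v) ≤ K₂ * (S.ups w * S.ups v)) ∧
      (∀ w v : List (Fin (2 * S.r)), IsWord w → IsWord v → arrow w v →
          K₂⁻¹ * (S.ups w * S.ups v) ≤ S.ups (w ++ v) ∧
          S.ups (w ++ v) ≤ K₂ * (S.ups w * S.ups v)) := by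
  obtain ⟨M, hM⟩ := S.exists_isBound
  have hM1 := hM.one_lt.le
  have conclude : ∀ x y : ℝ, 0 < y → NearOne M 20 (x / y) →
      (M ^ 20)⁻¹ * y ≤ x ∧ x ≤ M ^ 20 * y :=
    fun x y hy h => ⟨(le_div_iff₀ hy).1 h.1, (div_le_iff₀ hy).1 h.2⟩
  have ups_pos : ∀ w, IsWord w → 0 < S.ups w := fun w hw =>
    pos_of_mul_pos_left ((hM.ups_mul_lowerSq hw).pos hM1) (S.lowerSq_pos hw).le
  refine ⟨M ^ 20, one_lt_pow₀ hM.one_lt (by norm_num), ?_, ?_⟩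
  · intro w v hw hv hw0 _ hwv
    obtain ⟨u, a, rfl⟩ := (List.eq_nil_or_concat' w).resolve_left hw0
    obtain ⟨hu, -, hua⟩ := List.isChain_append.1 hw
    have huv : arrow u v := by
      intro x hx y hy
      refine hua x hx y ?_
      rw [← hwv.2.2] at hy
      simpa using hy
    rw [List.dropLast_concat]
    have hu0 := S.lowerSq_pos hu
    have hv0 := S.lowerSq_pos hv
    have huv0 := S.lowerSq_pos (isWord_append hu hv huv)
    have h1 := ups_pos _ hw
    have h2 := ups_pos _ hv
    refine conclude _ _ (mul_pos h1 h2) (NearOne.mono hM1 (by norm_num : 17 ≤ 20) ?_)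
    convert (((hM.ups_mul_lowerSq (isWord_append hu hv huv)).mul hM1
      ((hM.lowerSq_append hu hv huv).inv hM1)).mul hM1 ((hM.ups_concat hu hua).inv hM1)).mul hM1
      ((hM.ups_mul_lowerSq hv).inv hM1) using 1
    field_simp
  · intro w v hw hv hwv
    have hw0 := S.lowerSq_pos hw
    have hv0 := S.lowerSq_pos hv
    have hwv0 := S.lowerSq_pos (isWord_append hw hv hwv)
    have h1 := ups_pos _ hw
    have h2 := ups_pos _ hv
    refine conclude _ _ (mul_pos h1 h2) ?_
    convert (((hM.ups_mul_lowerSq (isWord_append hw hv hwv)).mul hM1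
      ((hM.lowerSq_append hw hv hwv).inv hM1)).mul hM1 ((hM.ups_mul_lowerSq hw).inv hM1)).mul hM1
      ((hM.ups_mul_lowerSq hv).inv hM1) using 1
    field_simp
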